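/- Let n, m be positive integers. Let U, V and U', V' be subspaces of F_q^m with dim U = dim U', dim V = dim V' and dim(U ∩ V) = dim(U' ∩ V'). Let M, M' ∈ F_q^{n×m} be matrices with row(M) = U and row(M') = U'. Then for every nonnegative integer r, the number of matrices B ∈ F_q^{n×m} of rank r with row(M + B) = V equals the number of matrices B' ∈ F_q^{n×m} of rank r with row(M' + B') = V'. That is, this count depends only on q, n, m, r, dim U, dim V and dim(U ∩ V). -/

import Mathlib

/-- The row space of a matrix `M ∈ F^{n×m}`, i.e. the span of its rows: this is the
range of the linear map `x ↦ x ᵥ* M` from `F^n` to `F^m`. -/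
noncomputable def rowSpace {F : Type*} [Field F] {n m : ℕ}
    (M : Matrix (Fin n) (Fin m) F) : Submodule F (Fin m → F) :=
  LinearMap.range M.vecMulLinear

/-- Two linear maps with the same range differ by an automorphism of the source. -/
theorem exists_linearEquiv_comp_eq_of_range_eq {K N W : Type*} [Field K]
    [AddCommGroup N] [Module K N] [FiniteDimensional K N] [AddCommGroup W] [Module K W]
    (f f' : N →ₗ[K] W) (hf : LinearMap.range f = LinearMap.range f') :
    ∃ h : N ≃ₗ[K] N, ∀ x, f' (h x) = f x := by
  have split : ∀ f : N →ₗ[K] W,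
      ∃ e : (LinearMap.ker f × LinearMap.range f) ≃ₗ[K] N, ∀ p, f (e p) = p.2 := by
    intro f
    obtain ⟨s, hs⟩ := f.rangeRestrict.exists_rightInverse_of_surjective f.range_rangeRestrict
    have hs' : ∀ w, f (s w) = w := fun w => congrArg Subtype.val (LinearMap.congr_fun hs w)
    have key : ∀ p, f ((LinearMap.ker f).subtype.coprod s p) = p.2 := by
      rintro ⟨k, w⟩
      simp [hs']
    refine ⟨LinearEquiv.ofBijective ((LinearMap.ker f).subtype.coprod s) ⟨?_, ?_⟩, key⟩
    · rw [injective_iff_map_eq_zero]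
      rintro ⟨k, w⟩ h0
      have hw := key (k, w)
      rw [h0, map_zero] at hw
      obtain rfl : w = 0 := Subtype.ext hw.symm
      simpa using h0
    · intro x
      refine ⟨(⟨x - s (f.rangeRestrict x), ?_⟩, f.rangeRestrict x), ?_⟩
      · simp [hs']
      · simp
  obtain ⟨e, he⟩ := split f
  obtain ⟨e', he'⟩ := split f'
  have hker : Module.finrank K (LinearMap.ker f) = Module.finrank K (LinearMap.ker f') := by
    have h1 := f.finrank_range_add_finrank_ker
    have h2 := f'.finrank_range_add_finrank_ker
    rw [hf] at h1
    omega
  refine ⟨e.symm ≪≫ₗ ((LinearEquiv.ofFinrankEq _ _ hker).prodCongr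
    (LinearEquiv.ofEq _ _ hf)) ≪≫ₗ e', fun x => ?_⟩
  have := he (e.symm x)
  simp only [LinearEquiv.apply_symm_apply] at this
  simp [he', this]

/-- A pair of subspaces is determined, up to an automorphism of the ambient space, by the
dimensions of the two subspaces and of their intersection. -/
theorem exists_linearEquiv_map_eq_map_eq {K W : Type*} [Field K]
    [AddCommGroup W] [Module K W] [FiniteDimensional K W] (U V U' V' : Submodule K W)
    (hU : Module.finrank K U = Module.finrank K U')
    (hV : Module.finrank K V = Module.finrank K V')
    (hUV : Module.finrank K (U ⊓ V : Submodule K W) =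
      Module.finrank K (U' ⊓ V' : Submodule K W)) :
    ∃ g : W ≃ₗ[K] W, U.map g.toLinearMap = U' ∧ V.map g.toLinearMap = V' := by
  have decomp : ∀ U V : Submodule K W, ∃ A B C : Submodule K W,
      (U ⊓ V) ⊔ A = U ∧ (U ⊓ V) ⊔ B = V ∧
      Module.finrank K (U ⊓ V : Submodule K W) + Module.finrank K A = Module.finrank K U ∧
      Module.finrank K (U ⊓ V : Submodule K W) + Module.finrank K B = Module.finrank K V ∧
      Module.finrank K U + Module.finrank K B + Module.finrank K C = Module.finrank K W ∧
      ∃ e : ((U ⊓ V : Submodule K W) × A × B × C) ≃ₗ[K] W,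
        ∀ i a b c, e (i, a, b, c) = (i : W) + (a + (b + c)) := by
    intro U V
    obtain ⟨A, hA, hA'⟩ := IsModularLattice.exists_disjoint_and_sup_eq
      (inf_le_left : U ⊓ V ≤ U)
    obtain ⟨B, hB, hB'⟩ := IsModularLattice.exists_disjoint_and_sup_eq
      (inf_le_right : U ⊓ V ≤ V)
    obtain ⟨C, hC⟩ := exists_isCompl (U ⊔ V)
    have d1 := Submodule.finrank_sup_add_finrank_inf_eq (U ⊓ V) A
    have d2 := Submodule.finrank_sup_add_finrank_inf_eq (U ⊓ V) B
    have d3 := Submodule.finrank_sup_add_finrank_inf_eq U V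
    have d4 := Submodule.finrank_add_eq_of_isCompl hC
    rw [hA', hA.eq_bot, finrank_bot] at d1
    rw [hB', hB.eq_bot, finrank_bot] at d2
    refine ⟨A, B, C, hA', hB', by omega, by omega, by omega, ?_⟩
    let φ : ((U ⊓ V : Submodule K W) × A × B × C) →ₗ[K] W :=
      (U ⊓ V).subtype.coprod (A.subtype.coprod (B.subtype.coprod C.subtype))
    have hsurj : Function.Surjective φ := by
      rw [← LinearMap.range_eq_top]
      simp only [φ, LinearMap.range_coprod, Submodule.range_subtype]
      rw [← sup_assoc, hA', ← sup_assoc, eq_top_iff, ← hC.sup_eq_top]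
      refine sup_le_sup_right (sup_le le_sup_left ?_) _
      rw [← hB']
      exact sup_le_sup_right inf_le_left _
    have hdim : Module.finrank K ((U ⊓ V : Submodule K W) × A × B × C) =
        Module.finrank K W := by
      simp only [Module.finrank_prod]
      omega
    exact ⟨LinearEquiv.ofBijective φ
      ⟨(LinearMap.injective_iff_surjective_of_finrank_eq_finrank hdim).2 hsurj, hsurj⟩,
      fun i a b c => rfl⟩
  obtain ⟨A, B, C, hA, hB, dA, dB, dC, e, he⟩ := decomp U V
  obtain ⟨A', B', C', hA', hB', dA', dB', dC', e', he'⟩ := decomp U' V'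
  let eI := LinearEquiv.ofFinrankEq _ _ hUV
  let eA : A ≃ₗ[K] A' := LinearEquiv.ofFinrankEq _ _ (by omega)
  let eB : B ≃ₗ[K] B' := LinearEquiv.ofFinrankEq _ _ (by omega)
  let eC : C ≃ₗ[K] C' := LinearEquiv.ofFinrankEq _ _ (by omega)
  let g : W ≃ₗ[K] W := e.symm ≪≫ₗ eI.prodCongr (eA.prodCongr (eB.prodCongr eC)) ≪≫ₗ e'
  have hg : ∀ (i : (U ⊓ V : Submodule K W)) (a : A) (b : B) (c : C), g ((i : W) + (a + (b + c))) =
      (eI i : W) + (eA a + (eB b + eC c)) := by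
    intro i a b c
    rw [← he, ← he']
    simp [g]
  have mapU : U.map g.toLinearMap ≤ U' := by
    rw [← hA, Submodule.map_sup, sup_le_iff, Submodule.map_le_iff_le_comap,
      Submodule.map_le_iff_le_comap]
    refine ⟨fun x hx => ?_, fun x hx => ?_⟩
    · have := hg ⟨x, hx⟩ 0 0 0
      simp only [ZeroMemClass.coe_zero, map_zero, add_zero] at this
      simpa [this] using inf_le_left (a := U') (b := V') (eI ⟨x, hx⟩).2
    · have := hg 0 ⟨x, hx⟩ 0 0
      simp only [ZeroMemClass.coe_zero, map_zero, add_zero, zero_add] at this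
      simpa [this] using (hA' ▸ le_sup_right : A' ≤ U') (eA ⟨x, hx⟩).2
  have mapV : V.map g.toLinearMap ≤ V' := by
    rw [← hB, Submodule.map_sup, sup_le_iff, Submodule.map_le_iff_le_comap,
      Submodule.map_le_iff_le_comap]
    refine ⟨fun x hx => ?_, fun x hx => ?_⟩
    · have := hg ⟨x, hx⟩ 0 0 0
      simp only [ZeroMemClass.coe_zero, map_zero, add_zero] at this
      simpa [this] using inf_le_right (a := U') (b := V') (eI ⟨x, hx⟩).2
    · have := hg 0 0 ⟨x, hx⟩ 0
      simp only [ZeroMemClass.coe_zero, map_zero, add_zero, zero_add] at this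
      simpa [this] using (hB' ▸ le_sup_right : B' ≤ V') (eB ⟨x, hx⟩).2
  exact ⟨g, Submodule.eq_of_le_of_finrank_eq mapU ((g.finrank_map_eq U).trans hU),
    Submodule.eq_of_le_of_finrank_eq mapV ((g.finrank_map_eq V).trans hV)⟩

theorem rank_eq_finrank_rowSpace {F : Type*} [Field F] {n m : ℕ}
    (B : Matrix (Fin n) (Fin m) F) : B.rank = Module.finrank F (rowSpace B) := by
  rw [rowSpace, range_vecMulLinear, Matrix.rank_eq_finrank_span_row]

/-- the number of rank-`r` matrices `B` with `row(M + B) = V` depends only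
on `q, n, m, r`, `dim U`, `dim V` and `dim (U ∩ V)`, where `U = row(M)`. -/
theorem count_matrices_fixed_rowspace_sum_well_defined
    (q n m : ℕ) (hn : 0 < n) (hm : 0 < m)
    (F : Type*) [Field F] [Fintype F] (hq : Fintype.card F = q)
    (U V U' V' : Submodule F (Fin m → F))
    (hU : Module.finrank F U = Module.finrank F U')
    (hV : Module.finrank F V = Module.finrank F V')
    (hUV : Module.finrank F (U ⊓ V : Submodule F (Fin m → F)) =
      Module.finrank F (U' ⊓ V' : Submodule F (Fin m → F)))
    (M M' : Matrix (Fin n) (Fin m) F)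
    (hM : rowSpace M = U) (hM' : rowSpace M' = U') (r : ℕ) :
    Nat.card {B : Matrix (Fin n) (Fin m) F // B.rank = r ∧ rowSpace (M + B) = V} =
      Nat.card {B' : Matrix (Fin n) (Fin m) F //
        B'.rank = r ∧ rowSpace (M' + B') = V'} := by
  obtain ⟨g, hgU, hgV⟩ := exists_linearEquiv_map_eq_map_eq U V U' V' hU hV hUV
  obtain ⟨h, hh⟩ := exists_linearEquiv_comp_eq_of_range_eq
    (g.toLinearMap ∘ₗ M.vecMulLinear) M'.vecMulLinear (by
      rw [LinearMap.range_comp]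
      change (rowSpace M).map g.toLinearMap = rowSpace M'
      rw [hM, hM', hgU])
  let L := LinearMap.toMatrixRight' (R := F) (m := Fin n) (n := Fin m)
  let T : Matrix (Fin n) (Fin m) F ≃+ Matrix (Fin n) (Fin m) F :=
    L.symm.toAddEquiv.trans ((LinearEquiv.arrowCongr h g).toAddEquiv.trans L.toAddEquiv)
  have hT : ∀ B, (T B).vecMulLinear = g.toLinearMap ∘ₗ B.vecMulLinear ∘ₗ h.symm.toLinearMap :=
    fun B => L.symm_apply_apply (LinearEquiv.arrowCongr h g (L.symm B))
  have hTM : T M = M' := by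
    apply L.symm.injective
    change (T M).vecMulLinear = M'.vecMulLinear
    rw [hT]
    refine LinearMap.ext fun x => ?_
    simpa using (hh (h.symm x)).symm
  have hrow : ∀ B, rowSpace (T B) = (rowSpace B).map g.toLinearMap := by
    intro B
    rw [rowSpace, hT, LinearMap.range_comp, LinearMap.range_comp, LinearEquiv.range,
      Submodule.map_top, rowSpace]
  refine Nat.card_congr (T.toEquiv.subtypeEquiv fun B => ?_)
  change _ ↔ (T B).rank = r ∧ rowSpace (M' + T B) = V'
  rw [← hTM, ← map_add, hrow, ← hgV, (Submodule.map_injective_of_injective g.injective).eq_iff,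
    rank_eq_finrank_rowSpace, rank_eq_finrank_rowSpace, hrow, g.finrank_map_eq]
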